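/- Let 1 < p ≤ q, a₀ ≥ 0, K₀(s) := s^p + a₀ s^q for s ≥ 0, and let K̃₀ denote the Young (convex) conjugate of K₀, i.e. K̃₀(t) := sup_{τ>0} (tτ − K₀(τ)). Then: (1) for every 0 < κ ≤ 1 and every s ≥ 0, K̃₀(κ s) ≤ κ^{q/(q−1)} K̃₀(s); (2) for every ε ∈ (0,1) and all s, t ≥ 0, the Young-type inequality s t ≤ K₀(s)/ε^{q−1} + ε K̃₀(t) holds. -/

import Mathlib

open Set
noncomputable section

/-- Scaling the argument of `s ^ p + a * s ^ q` by `c ≥ 1` costs at most a factor `c ^ q`. -/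
theorem rpow_add_mul_rpow_mul_le {p q a c s : ℝ} (hpq : p ≤ q) (hc : 1 ≤ c) (hs : 0 ≤ s) :
    (c * s) ^ p + a * (c * s) ^ q ≤ c ^ q * (s ^ p + a * s ^ q) := by
  have hc0 : 0 ≤ c := zero_le_one.trans hc
  rw [Real.mul_rpow hc0 hs, Real.mul_rpow hc0 hs]
  have h := mul_le_mul_of_nonneg_right (Real.rpow_le_rpow_of_exponent_le hc hpq)
    (Real.rpow_nonneg hs p)
  linarith

/-- The supremum defining the Young conjugate of `s ^ p + a * s ^ q` is finite. -/
theorem bddAbove_range_mul_sub_rpow_add {p q a : ℝ} (hp : 1 < p) (ha : 0 ≤ a)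
    {t : ℝ} (ht : 0 ≤ t) :
    BddAbove (range fun τ : Ioi (0 : ℝ) => t * (τ : ℝ) - ((τ : ℝ) ^ p + a * (τ : ℝ) ^ q)) := by
  refine ⟨t * t ^ (p - 1)⁻¹, ?_⟩
  rintro _ ⟨⟨τ, hτ : 0 < τ⟩, rfl⟩
  have hq : 0 ≤ a * τ ^ q := mul_nonneg ha (Real.rpow_nonneg hτ.le q)
  have hpow : τ ^ p = τ ^ (p - 1) * τ := by
    rw [← Real.rpow_add_one hτ.ne']; congr 1; ring
  rcases le_total t (τ ^ (p - 1)) with h | h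
  · have h1 := mul_le_mul_of_nonneg_right h hτ.le
    have h2 : 0 ≤ t * t ^ (p - 1)⁻¹ := mul_nonneg ht (Real.rpow_nonneg ht _)
    dsimp only
    linarith
  · have h1 : τ ≤ t ^ (p - 1)⁻¹ :=
      (Real.le_rpow_inv_iff_of_pos hτ.le ht (sub_pos.2 hp)).2 h
    have h2 := mul_le_mul_of_nonneg_left h1 ht
    have h3 : 0 ≤ τ ^ p := Real.rpow_nonneg hτ.le p
    dsimp only
    linarith

/-- The Fenchel–Young inequality for `s ^ p + a * s ^ q`, including the endpoint `s = 0`. -/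
theorem mul_sub_rpow_add_le_iSup {p q a : ℝ} (hp : 1 < p) (hpq : p ≤ q) (ha : 0 ≤ a)
    {s t : ℝ} (hs : 0 ≤ s) (ht : 0 ≤ t) :
    s * t - (s ^ p + a * s ^ q) ≤
      ⨆ τ : Ioi (0 : ℝ), (t * (τ : ℝ) - ((τ : ℝ) ^ p + a * (τ : ℝ) ^ q)) := by
  have hpos : ∀ x ∈ Ioi (0 : ℝ), x * t - (x ^ p + a * x ^ q) ≤
      ⨆ τ : Ioi (0 : ℝ), (t * (τ : ℝ) - ((τ : ℝ) ^ p + a * (τ : ℝ) ^ q)) := by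
    intro x hx
    rw [mul_comm x t]
    exact le_ciSup (bddAbove_range_mul_sub_rpow_add hp ha ht) ⟨x, hx⟩
  have hcont : Continuous fun x : ℝ => x * t - (x ^ p + a * x ^ q) := by
    have h1 := Real.continuous_rpow_const (q := p) (by linarith)
    have h2 := Real.continuous_rpow_const (q := q) (by linarith)
    fun_prop
  have hmem : s ∈ closure (Ioi (0 : ℝ)) := by
    rwa [closure_Ioi]
  exact closure_minimal hpos (isClosed_le hcont continuous_const) hmem

/-- Young conjugate inequalities (2.6)–(2.7). For
`K₀(s) = s^p + a₀ s^q` with `1 < p ≤ q`, `a₀ ≥ 0`, and its Young conjugate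
`K̃₀(t) = sup_{τ>0} (tτ − K₀(τ))`: (1) `K̃₀(κs) ≤ κ^{q/(q−1)} K̃₀(s)` for `0 < κ ≤ 1`;
(2) `st ≤ K₀(s)/ε^{q−1} + ε K̃₀(t)` for every `ε ∈ (0,1)` and `s,t ≥ 0`. -/
theorem young_conjugate_inequalities
    (p q a₀ : ℝ) (hp : 1 < p) (hpq : p ≤ q) (ha₀ : 0 ≤ a₀) :
    let K₀ : ℝ → ℝ := fun s => s ^ p + a₀ * s ^ q
    let Kc : ℝ → ℝ := fun t => ⨆ τ : Ioi (0:ℝ), (t * (τ : ℝ) - K₀ (τ : ℝ))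
    (∀ κ s : ℝ, 0 < κ → κ ≤ 1 → 0 ≤ s →
        Kc (κ * s) ≤ κ ^ (q / (q - 1)) * Kc s) ∧
    (∀ ε s t : ℝ, ε ∈ Ioo (0:ℝ) 1 → 0 ≤ s → 0 ≤ t →
        s * t ≤ K₀ s / ε ^ (q - 1) + ε * Kc t) := by
  intro K₀ Kc
  have hq : 0 < q - 1 := by linarith
  constructor
  · intro κ s hκ hκ1 hs
    have : Nonempty (Ioi (0 : ℝ)) := nonempty_Ioi_subtype
    refine ciSup_le ?_
    rintro ⟨τ, hτ : 0 < τ⟩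
    set c : ℝ := κ ^ (-(q - 1)⁻¹) with hc
    have hc1 : 1 ≤ c :=
      Real.one_le_rpow_of_pos_of_le_one_of_nonpos hκ hκ1 (by simpa using hq.le)
    have hc0 : 0 < c := zero_lt_one.trans_le hc1
    have hk0 : 0 ≤ κ ^ (q / (q - 1)) := Real.rpow_nonneg hκ.le _
    have hkc : κ ^ (q / (q - 1)) * c = κ := by
      rw [hc, ← Real.rpow_add hκ]
      convert Real.rpow_one κ using 2
      field_simp
      ring
    have hkcq : κ ^ (q / (q - 1)) * c ^ q = 1 := by
      rw [hc, ← Real.rpow_mul hκ.le, ← Real.rpow_add hκ]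
      convert Real.rpow_zero κ using 2
      field_simp
      ring
    have hY : c * τ * s - K₀ (c * τ) ≤ Kc s :=
      mul_sub_rpow_add_le_iSup hp hpq ha₀ (mul_pos hc0 hτ).le hs
    have hS : K₀ (c * τ) ≤ c ^ q * K₀ τ := rpow_add_mul_rpow_mul_le hpq hc1 hτ.le
    calc κ * s * τ - K₀ τ
        = κ ^ (q / (q - 1)) * (c * τ * s - c ^ q * K₀ τ) := by
          linear_combination (-(s * τ)) * hkc + K₀ τ * hkcq
      _ ≤ κ ^ (q / (q - 1)) * Kc s :=
          mul_le_mul_of_nonneg_left (by linarith) hk0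
  · rintro ε s t ⟨hε, hε1⟩ hs ht
    have hY : ε⁻¹ * s * t - K₀ (ε⁻¹ * s) ≤ Kc t :=
      mul_sub_rpow_add_le_iSup hp hpq ha₀ (mul_nonneg (inv_nonneg.2 hε.le) hs) ht
    have hS : K₀ (ε⁻¹ * s) ≤ ε⁻¹ ^ q * K₀ s :=
      rpow_add_mul_rpow_mul_le hpq ((one_le_inv₀ hε).2 hε1.le) hs
    have hpow : ε * ε⁻¹ ^ q = (ε ^ (q - 1))⁻¹ := by
      rw [Real.inv_rpow hε.le, Real.rpow_sub_one hε.ne', inv_div, div_eq_mul_inv]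
    calc s * t = ε * (ε⁻¹ * s * t) := by field_simp
      _ ≤ ε * (ε⁻¹ ^ q * K₀ s + Kc t) := mul_le_mul_of_nonneg_left (by linarith) hε.le
      _ = K₀ s / ε ^ (q - 1) + ε * Kc t := by
          rw [mul_add, ← mul_assoc, hpow, div_eq_mul_inv, mul_comm (K₀ s)]
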